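/- The invariant subring ℂ[x₁,x₂,x₃,x₄]^Γ (the subalgebra of polynomials fixed by the linear substitution action of Γ) equals the ℂ-subalgebra generated by the eight polynomials z₁ = x₁x₃+x₂x₄, z₂ = x₃⁴-2q x₃²x₄²+x₄⁴, z₃ = x₁⁴+2q x₁²x₂²+x₂⁴, z₄ = x₂x₃³-q x₁x₃²x₄+q x₂x₃x₄²-x₁x₄³, z₅ = x₂³x₃-q x₁²x₂x₃+q x₁x₂²x₄-x₁³x₄, z₆ = x₁⁵x₂-x₁x₂⁵, z₇ = x₃⁵x₄-x₃x₄⁵, z₈ = x₁x₂²x₃³-x₂³x₃²x₄-x₁³x₃x₄²+x₁²x₂x₄³. -/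

import Mathlib

/-!
STATEMENT 6: The invariant subring ℂ[x₁,x₂,x₃,x₄]^Γ (for the linear substitution
action of the group Γ ⊂ GL(4,ℂ) generated by g₁ = I₂ ⊕ ((I₂)ᵀ)⁻¹ and
g₂ = (ωτ) ⊕ (((ωτ)ᵀ)⁻¹)) equals the ℂ-subalgebra generated by the eight
polynomials z₁,…,z₈ of Table 1.
-/

noncomputable section

open Matrix MvPolynomial

/-- ω = e^{2πi/3} -/
noncomputable def ω : ℂ := Complex.exp (2 * Real.pi * Complex.I / 3)

/-- q = 2ω+1, a square root of -3 -/
noncomputable def q : ℂ := 2 * ω + 1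

/-- I₂ = [[i,0],[0,-i]] -/
def I₂ : Matrix (Fin 2) (Fin 2) ℂ := !![Complex.I, 0; 0, -Complex.I]

/-- τ = -(1/2)·[[1+i, -1+i],[1+i, 1-i]] -/
def τ : Matrix (Fin 2) (Fin 2) ℂ :=
  -(1 / 2 : ℂ) • !![1 + Complex.I, -1 + Complex.I; 1 + Complex.I, 1 - Complex.I]

/-- the block-diagonal 4×4 matrix A ⊕ D -/
def blockDiag (A D : Matrix (Fin 2) (Fin 2) ℂ) : Matrix (Fin 4) (Fin 4) ℂ :=
  Matrix.reindex finSumFinEquiv finSumFinEquiv (Matrix.fromBlocks A 0 0 D)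

/-- g₁ = I₂ ⊕ ((I₂)ᵀ)⁻¹ -/
noncomputable def g₁ : Matrix (Fin 4) (Fin 4) ℂ := blockDiag I₂ ((I₂ᵀ)⁻¹)

/-- g₂ = (ωτ) ⊕ (((ωτ)ᵀ)⁻¹) -/
noncomputable def g₂ : Matrix (Fin 4) (Fin 4) ℂ := blockDiag (ω • τ) (((ω • τ)ᵀ)⁻¹)

/-- linear substitution of variables by a matrix M : xⱼ ↦ ∑ᵢ Mⱼᵢ xᵢ -/
noncomputable def subst (M : Matrix (Fin 4) (Fin 4) ℂ) :
    MvPolynomial (Fin 4) ℂ →ₐ[ℂ] MvPolynomial (Fin 4) ℂ :=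
  MvPolynomial.aeval fun j => ∑ i, MvPolynomial.C (M j i) * MvPolynomial.X i

/-- the eight basic invariants of Table 1 (variables x₁,x₂,x₃,x₄ = X 0, X 1, X 2, X 3) -/
noncomputable def z : Fin 8 → MvPolynomial (Fin 4) ℂ :=
  ![X 0 * X 2 + X 1 * X 3,
    X 2 ^ 4 - C (2 * q) * X 2 ^ 2 * X 3 ^ 2 + X 3 ^ 4,
    X 0 ^ 4 + C (2 * q) * X 0 ^ 2 * X 1 ^ 2 + X 1 ^ 4,
    X 1 * X 2 ^ 3 - C q * X 0 * X 2 ^ 2 * X 3 + C q * X 1 * X 2 * X 3 ^ 2 - X 0 * X 3 ^ 3,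
    X 1 ^ 3 * X 2 - C q * X 0 ^ 2 * X 1 * X 2 + C q * X 0 * X 1 ^ 2 * X 3 - X 0 ^ 3 * X 3,
    X 0 ^ 5 * X 1 - X 0 * X 1 ^ 5,
    X 2 ^ 5 * X 3 - X 2 * X 3 ^ 5,
    X 0 * X 1 ^ 2 * X 2 ^ 3 - X 1 ^ 3 * X 2 ^ 2 * X 3 - X 0 ^ 3 * X 2 * X 3 ^ 2
      + X 0 ^ 2 * X 1 * X 3 ^ 3]


/-! ### Constants -/

lemma omega_sq : ω ^ 2 = -ω - 1 := by
  have h3 : ω ^ 3 = 1 := by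
    rw [ω, ← Complex.exp_nat_mul, ← Complex.exp_two_pi_mul_I]
    congr 1
    push_cast
    ring
  have h1 : ω ≠ 1 := by
    intro h
    rw [ω, Complex.exp_eq_one_iff] at h
    obtain ⟨n, hn⟩ := h
    have h2 : (2 * Real.pi * Complex.I : ℂ) ≠ 0 := Complex.two_pi_I_ne_zero
    have h4 : (1 : ℂ) = 3 * n := by
      apply mul_left_cancel₀ h2
      linear_combination 3 * hn
    have h5 : (1 : ℤ) = 3 * n := by exact_mod_cast h4
    omega
  have h6 : (ω - 1) * (ω ^ 2 + ω + 1) = 0 := by linear_combination h3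
  rcases mul_eq_zero.mp h6 with h | h
  · exact absurd (sub_eq_zero.mp h) h1
  · linear_combination h

/-- The ambient polynomial ring. -/
abbrev Pol := MvPolynomial (Fin 4) ℂ

/-- The constants ω, i, q, 1/2, 1/36 as polynomials. -/
def cW : Pol := C ω
def cJ : Pol := C Complex.I
def cQ : Pol := C q
def cH : Pol := C (1 / 2)
def cK : Pol := C (1 / 36)

lemma cW_sq : cW ^ 2 = -cW - 1 := by
  rw [cW, ← C_pow, omega_sq]; simp
lemma cJ_sq : cJ ^ 2 = -1 := by
  rw [cJ, ← C_pow, Complex.I_sq]; simp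
lemma cQ_eq : cQ = 2 * cW + 1 := by
  rw [cQ, cW, q, C_add, C_mul, C_1, show (C 2 : Pol) = 2 from map_ofNat C 2]
lemma cQ_sq : cQ ^ 2 = -3 := by
  rw [cQ_eq]; linear_combination 4 * cW_sq
lemma cH_eq : 2 * cH = 1 := by
  have h : (2 : Pol) = C 2 := (map_ofNat C 2).symm
  rw [cH, h, ← C_mul]; norm_num
lemma cK_eq : 36 * cK = 1 := by
  have h : (36 : Pol) = C 36 := (map_ofNat C 36).symm
  rw [cK, h, ← C_mul]; norm_num
lemma C_two_q : (C (2 * q) : Pol) = 2 * cQ := by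
  rw [cQ, C_mul, show (C 2 : Pol) = 2 from map_ofNat C 2]

/-! ### The two generators as substitutions -/

lemma g₁_eq : g₁ = !![Complex.I, 0, 0, 0; 0, -Complex.I, 0, 0;
    0, 0, -Complex.I, 0; 0, 0, 0, Complex.I] := by
  have h : (I₂ᵀ)⁻¹ = !![-Complex.I, 0; 0, Complex.I] := by
    apply Matrix.inv_eq_right_inv
    ext i j
    fin_cases i <;> fin_cases j <;> simp [I₂, Matrix.mul_apply, Fin.sum_univ_two]
  rw [g₁, h]
  ext i j
  fin_cases i <;> fin_cases j <;> rfl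

/-- The dual block of `g₂`. -/
def τd : Matrix (Fin 2) (Fin 2) ℂ :=
  !![-(1 / 2) * ω ^ 2 * (1 - Complex.I), -(1 / 2) * ω ^ 2 * (-1 - Complex.I);
    -(1 / 2) * ω ^ 2 * (1 - Complex.I), -(1 / 2) * ω ^ 2 * (1 + Complex.I)]

lemma τd_eq : ((ω • τ)ᵀ)⁻¹ = τd := by
  have h := omega_sq
  have hI := Complex.I_sq
  apply Matrix.inv_eq_right_inv
  ext i j
  fin_cases i <;> fin_cases j <;>
    simp [τ, τd, Matrix.mul_apply, Fin.sum_univ_two] <;> grind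

lemma subst_X (M : Matrix (Fin 4) (Fin 4) ℂ) (j : Fin 4) :
    subst M (X j) = ∑ i, C (M j i) * X i := by
  simp [subst]

lemma subst_C (M : Matrix (Fin 4) (Fin 4) ℂ) (c : ℂ) : subst M (C c) = C c := by
  simp [subst]

lemma subst_cW (M) : subst M cW = cW := subst_C M _
lemma subst_cJ (M) : subst M cJ = cJ := subst_C M _
lemma subst_cQ (M) : subst M cQ = cQ := subst_C M _
lemma subst_cH (M) : subst M cH = cH := subst_C M _

lemma subst_mul (M N : Matrix (Fin 4) (Fin 4) ℂ) (f : Pol) :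
    subst (M * N) f = subst N (subst M f) := by
  have h : subst (M * N) = (subst N).comp (subst M) := by
    apply MvPolynomial.algHom_ext
    intro j
    simp only [AlgHom.comp_apply, subst_X, map_sum, map_mul, subst_C, Matrix.mul_apply,
      Finset.sum_mul, Finset.mul_sum]
    rw [Finset.sum_comm]
    simp only [mul_assoc]
  rw [h]; rfl

lemma subst_one (f : Pol) : subst 1 f = f := by
  have h : subst 1 = AlgHom.id ℂ Pol := by
    apply MvPolynomial.algHom_ext
    intro j
    simp [subst_X, Matrix.one_apply]
  rw [h]; rfl

lemma a0 : subst g₁ (X 0) = cJ * X 0 := by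
  rw [subst_X, g₁_eq]; simp [Fin.sum_univ_four, cJ]
lemma a1 : subst g₁ (X 1) = -cJ * X 1 := by
  rw [subst_X, g₁_eq]; simp [Fin.sum_univ_four, cJ]
lemma a2 : subst g₁ (X 2) = -cJ * X 2 := by
  rw [subst_X, g₁_eq]; simp [Fin.sum_univ_four, cJ]
lemma a3 : subst g₁ (X 3) = cJ * X 3 := by
  rw [subst_X, g₁_eq]; simp [Fin.sum_univ_four, cJ]

lemma g₂_eq : g₂ = !![ω * τ 0 0, ω * τ 0 1, 0, 0; ω * τ 1 0, ω * τ 1 1, 0, 0;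
    0, 0, τd 0 0, τd 0 1; 0, 0, τd 1 0, τd 1 1] := by
  rw [g₂, τd_eq]
  ext i j
  fin_cases i <;> fin_cases j <;> rfl

lemma b0 : subst g₂ (X 0) = -cH * cW * ((1 + cJ) * X 0 + (-1 + cJ) * X 1) := by
  rw [subst_X, g₂_eq]
  simp [Fin.sum_univ_four, cJ, cW, cH, τ]
  ring
lemma b1 : subst g₂ (X 1) = -cH * cW * ((1 + cJ) * X 0 + (1 - cJ) * X 1) := by
  rw [subst_X, g₂_eq]
  simp [Fin.sum_univ_four, cJ, cW, cH, τ]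
  ring
lemma b2 : subst g₂ (X 2) = -cH * cW ^ 2 * ((1 - cJ) * X 2 + (-1 - cJ) * X 3) := by
  rw [subst_X, g₂_eq]
  simp [Fin.sum_univ_four, cJ, cW, cH, τd]
  ring
lemma b3 : subst g₂ (X 3) = -cH * cW ^ 2 * ((1 - cJ) * X 2 + (1 + cJ) * X 3) := by
  rw [subst_X, g₂_eq]
  simp [Fin.sum_univ_four, cJ, cW, cH, τd]
  ring

/-! ### Reduction steps: passing to the invariants of one more cyclic group -/

lemma step_two (T O S : Set Pol) (σ : Pol →ₐ[ℂ] Pol)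
    (hT : ∀ a ∈ T, σ a = a) (hO : ∀ k ∈ O, σ k = -k)
    (hOO : ∀ a ∈ O, ∀ b ∈ O, a * b ∈ Algebra.adjoin ℂ T)
    (hS : ∀ a ∈ S, a ∈ Algebra.adjoin ℂ T ∨ a ∈ O)
    (f : Pol) (hf : f ∈ Algebra.adjoin ℂ S) (hσ : σ f = f) : f ∈ Algebra.adjoin ℂ T := by
  set A := Algebra.adjoin ℂ T with hA
  have hAσ : ∀ a ∈ A, σ a = a := by
    intro a ha
    have : A ≤ AlgHom.equalizer σ (AlgHom.id ℂ Pol) := Algebra.adjoin_le hT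
    exact this ha
  let M : Submodule A Pol := Submodule.span A O
  have smulM : ∀ a ∈ A, ∀ k ∈ M, a * k ∈ M := fun a ha k hk => M.smul_mem ⟨a, ha⟩ hk
  have hMM : ∀ a ∈ M, ∀ b ∈ M, a * b ∈ A := by
    have h : M * M ≤ (1 : Submodule A Pol) := by
      rw [Submodule.span_mul_span, Submodule.span_le]
      rintro _ ⟨a, ha, b, hb, rfl⟩
      exact Submodule.mem_one.mpr ⟨⟨a * b, hOO a ha b hb⟩, rfl⟩
    intro a ha b hb
    obtain ⟨y, hy⟩ := Submodule.mem_one.mp (h (Submodule.mul_mem_mul ha hb))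
    rw [← hy]; exact y.2
  have hMσ : ∀ k ∈ M, σ k = -k := by
    intro k hk
    induction hk using Submodule.span_induction with
    | mem x hx => exact hO x hx
    | zero => simp
    | add x y _ _ hx hy => rw [map_add, hx, hy]; ring
    | smul a x _ hx =>
      change σ ((a : Pol) * x) = -((a : Pol) * x)
      rw [map_mul, hx, hAσ a a.2]; ring
  have key : ∀ f ∈ Algebra.adjoin ℂ S, ∃ a ∈ A, ∃ k ∈ M, f = a + k := by
    intro f hf
    induction hf using Algebra.adjoin_induction with
    | mem x hx =>
      rcases hS x hx with h | h
      · exact ⟨x, h, 0, M.zero_mem, by simp⟩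
      · exact ⟨0, A.zero_mem, x, Submodule.subset_span h, by simp⟩
    | algebraMap r => exact ⟨_, A.algebraMap_mem r, 0, M.zero_mem, by simp⟩
    | add x y _ _ hx hy =>
      obtain ⟨a, ha, k, hk, rfl⟩ := hx
      obtain ⟨b, hb, l, hl, rfl⟩ := hy
      exact ⟨a + b, A.add_mem ha hb, k + l, M.add_mem hk hl, by ring⟩
    | mul x y _ _ hx hy =>
      obtain ⟨a, ha, k, hk, rfl⟩ := hx
      obtain ⟨b, hb, l, hl, rfl⟩ := hy
      exact ⟨a * b + k * l, A.add_mem (A.mul_mem ha hb) (hMM k hk l hl), a * l + b * k,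
        M.add_mem (smulM a ha l hl) (smulM b hb k hk), by ring⟩
  obtain ⟨a, ha, k, hk, rfl⟩ := key f hf
  rw [map_add, hAσ a ha, hMσ k hk] at hσ
  have h2 : (2 : Pol) * k = 0 := by linear_combination -hσ
  have hk0 : k = 0 := by linear_combination cH * h2 - k * cH_eq
  rw [hk0, add_zero]; exact ha

lemma step_three (T O P S : Set Pol) (σ : Pol →ₐ[ℂ] Pol)
    (hT : ∀ a ∈ T, σ a = a) (hO : ∀ k ∈ O, σ k = cW * k) (hP : ∀ k ∈ P, σ k = cW ^ 2 * k)
    (hOO : ∀ a ∈ O, ∀ b ∈ O, a * b ∈ Submodule.span (Algebra.adjoin ℂ T) P)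
    (hOP : ∀ a ∈ O, ∀ b ∈ P, a * b ∈ Algebra.adjoin ℂ T)
    (hPP : ∀ a ∈ P, ∀ b ∈ P, a * b ∈ Submodule.span (Algebra.adjoin ℂ T) O)
    (hS : ∀ a ∈ S, a ∈ Algebra.adjoin ℂ T ∨ a ∈ O ∨ a ∈ P)
    (f : Pol) (hf : f ∈ Algebra.adjoin ℂ S) (hσ : σ f = f) : f ∈ Algebra.adjoin ℂ T := by
  set A := Algebra.adjoin ℂ T with hA
  have hAσ : ∀ a ∈ A, σ a = a := by
    intro a ha
    have : A ≤ AlgHom.equalizer σ (AlgHom.id ℂ Pol) := Algebra.adjoin_le hT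
    exact this ha
  let M : Submodule A Pol := Submodule.span A O
  let N : Submodule A Pol := Submodule.span A P
  have smulM : ∀ a ∈ A, ∀ k ∈ M, a * k ∈ M := fun a ha k hk => M.smul_mem ⟨a, ha⟩ hk
  have smulN : ∀ a ∈ A, ∀ k ∈ N, a * k ∈ N := fun a ha k hk => N.smul_mem ⟨a, ha⟩ hk
  have hMN : ∀ a ∈ M, ∀ b ∈ N, a * b ∈ A := by
    have h : M * N ≤ (1 : Submodule A Pol) := by
      rw [Submodule.span_mul_span, Submodule.span_le]
      rintro _ ⟨a, ha, b, hb, rfl⟩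
      exact Submodule.mem_one.mpr ⟨⟨a * b, hOP a ha b hb⟩, rfl⟩
    intro a ha b hb
    obtain ⟨y, hy⟩ := Submodule.mem_one.mp (h (Submodule.mul_mem_mul ha hb))
    rw [← hy]; exact y.2
  have hMM : ∀ a ∈ M, ∀ b ∈ M, a * b ∈ N := by
    have h : M * M ≤ N := by
      rw [Submodule.span_mul_span, Submodule.span_le]
      rintro _ ⟨a, ha, b, hb, rfl⟩
      exact hOO a ha b hb
    exact fun a ha b hb => h (Submodule.mul_mem_mul ha hb)
  have hNN : ∀ a ∈ N, ∀ b ∈ N, a * b ∈ M := by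
    have h : N * N ≤ M := by
      rw [Submodule.span_mul_span, Submodule.span_le]
      rintro _ ⟨a, ha, b, hb, rfl⟩
      exact hPP a ha b hb
    exact fun a ha b hb => h (Submodule.mul_mem_mul ha hb)
  have eig : ∀ (c : Pol) (V : Set Pol), (∀ k ∈ V, σ k = c * k) →
      ∀ k ∈ Submodule.span A V, σ k = c * k := by
    intro c V hV k hk
    induction hk using Submodule.span_induction with
    | mem x hx => exact hV x hx
    | zero => simp
    | add x y _ _ hx hy => rw [map_add, hx, hy]; ring
    | smul a x _ hx =>
      change σ ((a : Pol) * x) = c * ((a : Pol) * x)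
      rw [map_mul, hx, hAσ a a.2]; ring
  have key : ∀ f ∈ Algebra.adjoin ℂ S, ∃ a ∈ A, ∃ k ∈ M, ∃ m ∈ N, f = a + k + m := by
    intro f hf
    induction hf using Algebra.adjoin_induction with
    | mem x hx =>
      rcases hS x hx with h | h | h
      · exact ⟨x, h, 0, M.zero_mem, 0, N.zero_mem, by simp⟩
      · exact ⟨0, A.zero_mem, x, Submodule.subset_span h, 0, N.zero_mem, by simp⟩
      · exact ⟨0, A.zero_mem, 0, M.zero_mem, x, Submodule.subset_span h, by simp⟩
    | algebraMap r => exact ⟨_, A.algebraMap_mem r, 0, M.zero_mem, 0, N.zero_mem, by simp⟩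
    | add x y _ _ hx hy =>
      obtain ⟨a, ha, k, hk, m, hm, rfl⟩ := hx
      obtain ⟨b, hb, l, hl, n, hn, rfl⟩ := hy
      exact ⟨a + b, A.add_mem ha hb, k + l, M.add_mem hk hl, m + n, N.add_mem hm hn, by ring⟩
    | mul x y _ _ hx hy =>
      obtain ⟨a, ha, k, hk, m, hm, rfl⟩ := hx
      obtain ⟨b, hb, l, hl, n, hn, rfl⟩ := hy
      exact ⟨a * b + (k * n + l * m),
        A.add_mem (A.mul_mem ha hb) (A.add_mem (hMN k hk n hn) (hMN l hl m hm)),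
        a * l + b * k + m * n,
        M.add_mem (M.add_mem (smulM a ha l hl) (smulM b hb k hk)) (hNN m hm n hn),
        a * n + b * m + k * l,
        N.add_mem (N.add_mem (smulN a ha n hn) (smulN b hb m hm)) (hMM k hk l hl), by ring⟩
  obtain ⟨a, ha, k, hk, m, hm, rfl⟩ := key f hf
  have h1 := hσ
  rw [map_add, map_add, hAσ a ha, eig _ O hO k hk, eig _ P hP m hm] at h1
  have h2 : σ (a + cW * k + cW ^ 2 * m) = a + cW * k + cW ^ 2 * m := by rw [h1]; exact hσ
  have h3 : σ (cW * k) = cW * (cW * k) := eig _ O hO _ (smulM _ (A.algebraMap_mem ω) k hk)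
  have h4 : σ (cW ^ 2 * m) = cW ^ 2 * (cW ^ 2 * m) :=
    eig _ P hP _ (smulN _ (A.pow_mem (A.algebraMap_mem ω) 2) m hm)
  rw [map_add, map_add, hAσ a ha, h3, h4] at h2
  have hw := cW_sq
  have h5 : 3 * (k + m) = 0 := by grind
  have h6 : k + m = 0 := by linear_combination 12 * cK * h5 - (k + m) * cK_eq
  have h7 : a + k + m = a := by linear_combination h6
  rw [h7]; exact ha

/-! ### Auxiliary polynomials -/

/-- Quadrics: three families on which the quaternion group acts by its nontrivial signs. -/
def u11 : Pol := X 0 * X 1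
def u12 : Pol := X 0 * X 2 - X 1 * X 3
def u13 : Pol := X 2 * X 3
def u21 : Pol := X 0 ^ 2 + X 1 ^ 2
def u22 : Pol := X 0 * X 3 - X 1 * X 2
def u23 : Pol := X 2 ^ 2 + X 3 ^ 2
def u31 : Pol := X 0 ^ 2 - X 1 ^ 2
def u32 : Pol := X 0 * X 3 + X 1 * X 2
def u33 : Pol := X 2 ^ 2 - X 3 ^ 2

/-- Invariants of the quaternion group of weight one for `g₂`. -/
def p1 : Pol :=
  X 1 ^ 3 * X 2 + cQ * X 0 ^ 2 * X 1 * X 2 - cQ * X 0 * X 1 ^ 2 * X 3 - X 0 ^ 3 * X 3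
def p2 : Pol :=
  3 * X 0 ^ 2 * X 3 ^ 2 - cQ * X 0 ^ 2 * X 2 ^ 2 + 4 * cQ * X 0 * X 1 * X 2 * X 3 + 3 * X 1 ^ 2 * X 2 ^ 2 - cQ * X 1 ^ 2 * X 3 ^ 2
def p3 : Pol :=
  X 2 ^ 4 + 2 * cQ * X 2 ^ 2 * X 3 ^ 2 + X 3 ^ 4
def p4 : Pol :=
  X 0 ^ 5 * X 2 - 5 * X 0 ^ 4 * X 1 * X 3 - 5 * X 0 * X 1 ^ 4 * X 2 + X 1 ^ 5 * X 3
def p5 : Pol :=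
  X 0 * X 1 * X 2 ^ 4 - 2 * X 1 ^ 2 * X 2 ^ 3 * X 3 + 2 * X 0 ^ 2 * X 2 * X 3 ^ 3 - X 0 * X 1 * X 3 ^ 4

/-- Invariants of the quaternion group of weight two for `g₂`. -/
def r1 : Pol :=
  X 0 ^ 4 - 2 * cQ * X 0 ^ 2 * X 1 ^ 2 + X 1 ^ 4
def r2 : Pol :=
  3 * X 0 ^ 2 * X 3 ^ 2 + cQ * X 0 ^ 2 * X 2 ^ 2 - 4 * cQ * X 0 * X 1 * X 2 * X 3 + 3 * X 1 ^ 2 * X 2 ^ 2 + cQ * X 1 ^ 2 * X 3 ^ 2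
def r3 : Pol :=
  X 1 * X 2 ^ 3 + cQ * X 0 * X 2 ^ 2 * X 3 - cQ * X 1 * X 2 * X 3 ^ 2 - X 0 * X 3 ^ 3
def r4 : Pol :=
  X 0 ^ 4 * X 2 * X 3 - 2 * X 0 ^ 3 * X 1 * X 3 ^ 2 + 2 * X 0 * X 1 ^ 3 * X 2 ^ 2 - X 1 ^ 4 * X 2 * X 3
def r5 : Pol :=
  X 0 * X 2 ^ 5 - 5 * X 0 * X 2 * X 3 ^ 4 - 5 * X 1 * X 2 ^ 4 * X 3 + X 1 * X 3 ^ 5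

lemma z_0 : z 0 = X 0 * X 2 + X 1 * X 3 := rfl
lemma z_1 : z 1 = X 2 ^ 4 - (2 * cQ) * X 2 ^ 2 * X 3 ^ 2 + X 3 ^ 4 := by
  rw [← C_two_q]; rfl
lemma z_2 : z 2 = X 0 ^ 4 + (2 * cQ) * X 0 ^ 2 * X 1 ^ 2 + X 1 ^ 4 := by
  rw [← C_two_q]; rfl
lemma z_3 : z 3 = X 1 * X 2 ^ 3 - cQ * X 0 * X 2 ^ 2 * X 3 + cQ * X 1 * X 2 * X 3 ^ 2 - X 0 * X 3 ^ 3 := rfl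
lemma z_4 : z 4 = X 1 ^ 3 * X 2 - cQ * X 0 ^ 2 * X 1 * X 2 + cQ * X 0 * X 1 ^ 2 * X 3 - X 0 ^ 3 * X 3 := rfl
lemma z_5 : z 5 = X 0 ^ 5 * X 1 - X 0 * X 1 ^ 5 := rfl
lemma z_6 : z 6 = X 2 ^ 5 * X 3 - X 2 * X 3 ^ 5 := rfl
lemma z_7 : z 7 = X 0 * X 1 ^ 2 * X 2 ^ 3 - X 1 ^ 3 * X 2 ^ 2 * X 3 - X 0 ^ 3 * X 2 * X 3 ^ 2 + X 0 ^ 2 * X 1 * X 3 ^ 3 := rfl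

/-! ### The identities -/

set_option linter.unusedSimpArgs false

lemma id_pr1 :
    p1 * r1 = (2 * cQ) * z 5 * z 0 + z 2 * z 4 ∧
    p1 * r2 = 3 * z 2 * z 3 + (-2 * cQ) * z 4 * z 0 * z 0 ∧
    p1 * r3 = (2 * cQ) * z 7 * z 0 + z 3 * z 4 ∧
    p1 * r4 = z 7 * z 2 + (-1) * z 5 * z 3 ∧
    p1 * r5 = (2 * cQ) * z 3 * z 0 * z 0 * z 0 + z 1 * z 4 * z 0 + (-6) * z 6 * z 2 := by
  have hQ := cQ_sq
  have hK := cK_eq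
  simp only [z_0, z_1, z_2, z_3, z_4, z_5, z_6, z_7,
    u11, u12, u13, u21, u22, u23, u31, u32, u33,
    p1, p2, p3, p4, p5, r1, r2, r3, r4, r5]
  generalize (X 0 : Pol) = a, (X 1 : Pol) = b, (X 2 : Pol) = c, (X 3 : Pol) = d
  generalize cQ = Q at *
  generalize cK = K at *
  refine ⟨?_, ?_, ?_, ?_, ?_⟩ <;> grind

lemma id_pr2 :
    p2 * r1 = 3 * z 4 * z 4 + (-cQ) * z 2 * z 0 * z 0 ∧
    p2 * r2 = 3 * z 1 * z 2 + 6 * z 3 * z 4 ∧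
    p2 * r3 = 3 * z 1 * z 4 + (2 * cQ) * z 3 * z 0 * z 0 ∧
    p2 * r4 = 4 * z 7 * z 4 + z 2 * z 3 * z 0 + (-1) * z 5 * z 1 ∧
    p2 * r5 = (-cQ) * z 1 * z 0 * z 0 * z 0 + (-6) * z 3 * z 3 * z 0 + 9 * z 7 * z 1 := by
  have hQ := cQ_sq
  have hK := cK_eq
  simp only [z_0, z_1, z_2, z_3, z_4, z_5, z_6, z_7,
    u11, u12, u13, u21, u22, u23, u31, u32, u33,
    p1, p2, p3, p4, p5, r1, r2, r3, r4, r5]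
  generalize (X 0 : Pol) = a, (X 1 : Pol) = b, (X 2 : Pol) = c, (X 3 : Pol) = d
  generalize cQ = Q at *
  generalize cK = K at *
  refine ⟨?_, ?_, ?_, ?_, ?_⟩ <;> grind

lemma id_pr3 :
    p3 * r1 = (-4 * cQ) * z 7 * z 0 + z 1 * z 2 ∧
    p3 * r2 = 3 * z 3 * z 3 + cQ * z 1 * z 0 * z 0 ∧
    p3 * r3 = (2 * cQ) * z 6 * z 0 + z 1 * z 3 ∧
    p3 * r4 = z 6 * z 2 + 2 * z 7 * z 3 ∧
    p3 * r5 = (-6) * z 6 * z 3 + z 1 * z 1 * z 0 := by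
  have hQ := cQ_sq
  have hK := cK_eq
  simp only [z_0, z_1, z_2, z_3, z_4, z_5, z_6, z_7,
    u11, u12, u13, u21, u22, u23, u31, u32, u33,
    p1, p2, p3, p4, p5, r1, r2, r3, r4, r5]
  generalize (X 0 : Pol) = a, (X 1 : Pol) = b, (X 2 : Pol) = c, (X 3 : Pol) = d
  generalize cQ = Q at *
  generalize cK = K at *
  refine ⟨?_, ?_, ?_, ?_, ?_⟩ <;> grind

lemma id_pr4 :
    p4 * r1 = 6 * z 5 * z 4 + z 2 * z 2 * z 0 ∧
    p4 * r2 = cQ * z 2 * z 0 * z 0 * z 0 + 3 * z 4 * z 4 * z 0 + 18 * z 5 * z 3 ∧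
    p4 * r3 = z 2 * z 3 * z 0 + (-2 * cQ) * z 4 * z 0 * z 0 * z 0 + 6 * z 5 * z 1 ∧
    p4 * r4 = (-1) * z 2 * z 4 * z 0 * z 0 + (-cQ) * z 5 * z 0 * z 0 * z 0 + 9 * z 5 * z 7 ∧
    p4 * r5 = 6 * z 3 * z 4 * z 0 * z 0 + cQ * z 2 * z 3 * z 3 + (-cQ) * z 1 * z 4 * z 4 + z 1 * z 2 * z 0 * z 0 := by
  have hQ := cQ_sq
  have hK := cK_eq
  simp only [z_0, z_1, z_2, z_3, z_4, z_5, z_6, z_7,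
    u11, u12, u13, u21, u22, u23, u31, u32, u33,
    p1, p2, p3, p4, p5, r1, r2, r3, r4, r5]
  generalize (X 0 : Pol) = a, (X 1 : Pol) = b, (X 2 : Pol) = c, (X 3 : Pol) = d
  generalize cQ = Q at *
  generalize cK = K at *
  refine ⟨?_, ?_, ?_, ?_, ?_⟩ <;> grind

lemma id_pr5 :
    p5 * r1 = z 5 * z 1 + 2 * z 7 * z 4 ∧
    p5 * r2 = (4 * cQ) * z 3 * z 0 * z 0 * z 0 + 3 * z 1 * z 4 * z 0 + (-9) * z 6 * z 2 ∧
    p5 * r3 = (-1) * z 6 * z 4 + z 7 * z 1 ∧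
    p5 * r4 = z 5 * z 6 + 2 * z 7 * z 7 ∧
    p5 * r5 = z 1 * z 3 * z 0 * z 0 + cQ * z 6 * z 0 * z 0 * z 0 + (-9) * z 6 * z 7 := by
  have hQ := cQ_sq
  have hK := cK_eq
  simp only [z_0, z_1, z_2, z_3, z_4, z_5, z_6, z_7,
    u11, u12, u13, u21, u22, u23, u31, u32, u33,
    p1, p2, p3, p4, p5, r1, r2, r3, r4, r5]
  generalize (X 0 : Pol) = a, (X 1 : Pol) = b, (X 2 : Pol) = c, (X 3 : Pol) = d
  generalize cQ = Q at *
  generalize cK = K at *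
  refine ⟨?_, ?_, ?_, ?_, ?_⟩ <;> grind

lemma id_cube :
    r1 * r1 * r1 = (-12 * cQ) * z 5 * z 5 + z 2 * z 2 * z 2 ∧
    p3 * p3 * p3 = (12 * cQ) * z 6 * z 6 + z 1 * z 1 * z 1 := by
  have hQ := cQ_sq
  have hK := cK_eq
  simp only [z_0, z_1, z_2, z_3, z_4, z_5, z_6, z_7,
    u11, u12, u13, u21, u22, u23, u31, u32, u33,
    p1, p2, p3, p4, p5, r1, r2, r3, r4, r5]
  generalize (X 0 : Pol) = a, (X 1 : Pol) = b, (X 2 : Pol) = c, (X 3 : Pol) = d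
  generalize cQ = Q at *
  generalize cK = K at *
  refine ⟨?_, ?_⟩ <;> grind

lemma id_sq1 :
    p1 * p1 = (cK * (12) * z 2) * r2 + (cK * (-12 * cQ) * z 0 * z 0) * r1 ∧
    p1 * p2 = ((4 * cQ) * z 0) * r4 + (3 * z 3) * r1 ∧
    p1 * p3 = (cK * (12) * z 3) * r2 + (cK * (24 * cQ) * z 0 * z 0) * r3 ∧
    p1 * p4 = (z 4 * z 0) * r1 + (2 * z 5) * r2 ∧
    p1 * p5 = (z 7) * r2 + ((-1) * z 3) * r4 ∧
    r1 * r2 = (z 2) * p2 + ((2 * cQ) * z 0) * p4 ∧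
    r1 * r3 = (cK * (12) * z 4) * p2 + (cK * (-24 * cQ) * z 0 * z 0) * p1 ∧
    r1 * r4 = (z 5) * p2 + ((-1) * z 4) * p4 ∧
    r1 * r5 = (2 * z 7) * p2 + (z 1) * p4 := by
  have hQ := cQ_sq
  have hK := cK_eq
  simp only [z_0, z_1, z_2, z_3, z_4, z_5, z_6, z_7,
    u11, u12, u13, u21, u22, u23, u31, u32, u33,
    p1, p2, p3, p4, p5, r1, r2, r3, r4, r5]
  generalize (X 0 : Pol) = a, (X 1 : Pol) = b, (X 2 : Pol) = c, (X 3 : Pol) = d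
  generalize cQ = Q at *
  generalize cK = K at *
  refine ⟨?_, ?_, ?_, ?_, ?_, ?_, ?_, ?_, ?_⟩ <;> grind

lemma id_sq2 :
    p2 * p2 = ((4 * cQ) * z 0 * z 0) * r2 + (9 * z 1) * r1 ∧
    p2 * p3 = ((-1) * z 1) * r2 + (6 * z 3) * r3 ∧
    p2 * p4 = ((-1) * z 2 * z 0) * r2 + ((-6) * z 4) * r4 ∧
    p2 * p5 = ((-1) * z 3 * z 0) * r2 + (3 * z 1) * r4 ∧
    r2 * r2 = ((-cQ) * z 0 * z 0) * p2 + (9 * z 3) * p1 ∧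
    r2 * r3 = (2 * z 3) * p2 + ((-3) * z 4) * p3 ∧
    r2 * r4 = (6 * z 7) * p1 + (z 4 * z 0) * p2 + (3 * z 5) * p3 ∧
    r2 * r5 = ((-1) * z 1 * z 0) * p2 + (6 * z 3) * p5 := by
  have hQ := cQ_sq
  have hK := cK_eq
  simp only [z_0, z_1, z_2, z_3, z_4, z_5, z_6, z_7,
    u11, u12, u13, u21, u22, u23, u31, u32, u33,
    p1, p2, p3, p4, p5, r1, r2, r3, r4, r5]
  generalize (X 0 : Pol) = a, (X 1 : Pol) = b, (X 2 : Pol) = c, (X 3 : Pol) = d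
  generalize cQ = Q at *
  generalize cK = K at *
  refine ⟨?_, ?_, ?_, ?_, ?_, ?_, ?_, ?_⟩ <;> grind

lemma id_sq3 :
    p3 * p4 = (z 2) * r5 + ((-2) * z 7) * r2 ∧
    p3 * p5 = (z 6) * r2 + (z 3) * r5 ∧
    r3 * r3 = (cK * (12) * z 1) * p2 + (cK * (12 * cQ) * z 0 * z 0) * p3 ∧
    r3 * r4 = ((-1) * z 4) * p5 + (z 7) * p2 ∧
    r3 * r5 = ((-1) * z 6) * p2 + (z 1) * p5 := by
  have hQ := cQ_sq
  have hK := cK_eq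
  simp only [z_0, z_1, z_2, z_3, z_4, z_5, z_6, z_7,
    u11, u12, u13, u21, u22, u23, u31, u32, u33,
    p1, p2, p3, p4, p5, r1, r2, r3, r4, r5]
  generalize (X 0 : Pol) = a, (X 1 : Pol) = b, (X 2 : Pol) = c, (X 3 : Pol) = d
  generalize cQ = Q at *
  generalize cK = K at *
  refine ⟨?_, ?_, ?_, ?_, ?_⟩ <;> grind

lemma id_sq4 :
    p4 * p4 = (z 2 * z 0 * z 0) * r1 + ((-12) * z 5) * r4 ∧
    p4 * p5 = ((-2) * z 7) * r4 + (z 5) * r5 ∧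
    r4 * r4 = (z 5) * p5 + ((-1) * z 7) * p4 ∧
    r4 * r5 = (z 6) * p4 + (2 * z 7) * p5 := by
  have hQ := cQ_sq
  have hK := cK_eq
  simp only [z_0, z_1, z_2, z_3, z_4, z_5, z_6, z_7,
    u11, u12, u13, u21, u22, u23, u31, u32, u33,
    p1, p2, p3, p4, p5, r1, r2, r3, r4, r5]
  generalize (X 0 : Pol) = a, (X 1 : Pol) = b, (X 2 : Pol) = c, (X 3 : Pol) = d
  generalize cQ = Q at *
  generalize cK = K at *
  refine ⟨?_, ?_, ?_, ?_⟩ <;> grind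

lemma id_sq5 :
    p5 * p5 = (z 7) * r5 + (z 6) * r4 ∧
    r5 * r5 = (z 1 * z 0 * z 0) * p3 + ((-12) * z 6) * p5 := by
  have hQ := cQ_sq
  have hK := cK_eq
  simp only [z_0, z_1, z_2, z_3, z_4, z_5, z_6, z_7,
    u11, u12, u13, u21, u22, u23, u31, u32, u33,
    p1, p2, p3, p4, p5, r1, r2, r3, r4, r5]
  generalize (X 0 : Pol) = a, (X 1 : Pol) = b, (X 2 : Pol) = c, (X 3 : Pol) = d
  generalize cQ = Q at *
  generalize cK = K at *
  refine ⟨?_, ?_⟩ <;> grind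

lemma id_u1 :
    u11 * u11 = (cK * (3 * cQ)) * r1 + cK * (-3 * cQ) * z 2 ∧
    u11 * u12 = (cK * (-6 * cQ)) * p1 + cK * (6 * cQ) * z 4 ∧
    u11 * u13 = cK * (6) * z 0 * z 0 + (cK * (cQ)) * r2 + (cK * (-cQ)) * p2 ∧
    u12 * u12 = (cK * (-4 * cQ)) * r2 + (cK * (4 * cQ)) * p2 + cK * (12) * z 0 * z 0 ∧
    u12 * u13 = (cK * (-6 * cQ)) * r3 + cK * (6 * cQ) * z 3 ∧
    u13 * u13 = (cK * (-3 * cQ)) * p3 + cK * (3 * cQ) * z 1 := by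
  have hQ := cQ_sq
  have hK := cK_eq
  simp only [z_0, z_1, z_2, z_3, z_4, z_5, z_6, z_7,
    u11, u12, u13, u21, u22, u23, u31, u32, u33,
    p1, p2, p3, p4, p5, r1, r2, r3, r4, r5]
  generalize (X 0 : Pol) = a, (X 1 : Pol) = b, (X 2 : Pol) = c, (X 3 : Pol) = d
  generalize cQ = Q at *
  generalize cK = K at *
  refine ⟨?_, ?_, ?_, ?_, ?_, ?_⟩ <;> grind

lemma id_u2 :
    u21 * u21 = cK * (18 + -6 * cQ) * z 2 + (cK * (18 + 6 * cQ)) * r1 ∧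
    u21 * u22 = cK * (-18 + -6 * cQ) * z 4 + (cK * (-18 + 6 * cQ)) * p1 ∧
    u21 * u23 = (cK * (6 + 2 * cQ)) * p2 + (cK * (6 + -2 * cQ)) * r2 + cK * (24) * z 0 * z 0 ∧
    u22 * u22 = (cK * (6 + 2 * cQ)) * p2 + (cK * (6 + -2 * cQ)) * r2 + cK * (-12) * z 0 * z 0 ∧
    u22 * u23 = cK * (-18 + 6 * cQ) * z 3 + (cK * (-18 + -6 * cQ)) * r3 ∧
    u23 * u23 = cK * (18 + 6 * cQ) * z 1 + (cK * (18 + -6 * cQ)) * p3 := by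
  have hQ := cQ_sq
  have hK := cK_eq
  simp only [z_0, z_1, z_2, z_3, z_4, z_5, z_6, z_7,
    u11, u12, u13, u21, u22, u23, u31, u32, u33,
    p1, p2, p3, p4, p5, r1, r2, r3, r4, r5]
  generalize (X 0 : Pol) = a, (X 1 : Pol) = b, (X 2 : Pol) = c, (X 3 : Pol) = d
  generalize cQ = Q at *
  generalize cK = K at *
  refine ⟨?_, ?_, ?_, ?_, ?_, ?_⟩ <;> grind

lemma id_u3 :
    u31 * u31 = cK * (18 + 6 * cQ) * z 2 + (cK * (18 + -6 * cQ)) * r1 ∧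
    u31 * u32 = cK * (-18 + 6 * cQ) * z 4 + (cK * (-18 + -6 * cQ)) * p1 ∧
    u31 * u33 = (cK * (-6 + 2 * cQ)) * p2 + (cK * (-6 + -2 * cQ)) * r2 + cK * (24) * z 0 * z 0 ∧
    u32 * u32 = (cK * (6 + -2 * cQ)) * p2 + (cK * (6 + 2 * cQ)) * r2 + cK * (12) * z 0 * z 0 ∧
    u32 * u33 = cK * (18 + 6 * cQ) * z 3 + (cK * (18 + -6 * cQ)) * r3 ∧
    u33 * u33 = cK * (18 + -6 * cQ) * z 1 + (cK * (18 + 6 * cQ)) * p3 := by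
  have hQ := cQ_sq
  have hK := cK_eq
  simp only [z_0, z_1, z_2, z_3, z_4, z_5, z_6, z_7,
    u11, u12, u13, u21, u22, u23, u31, u32, u33,
    p1, p2, p3, p4, p5, r1, r2, r3, r4, r5]
  generalize (X 0 : Pol) = a, (X 1 : Pol) = b, (X 2 : Pol) = c, (X 3 : Pol) = d
  generalize cQ = Q at *
  generalize cK = K at *
  refine ⟨?_, ?_, ?_, ?_, ?_, ?_⟩ <;> grind

lemma id_v1 :
    u11 * u21 * u31 = z 5 ∧
    u11 * u21 * u32 = cK * (3 + -3 * cQ) * z 2 * z 0 + (cK * (-6)) * p4 + (cK * (3 + 3 * cQ) * z 0) * r1 ∧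
    u11 * u21 * u33 = cK * (6 + 6 * cQ) * z 4 * z 0 + (cK * (12)) * r4 + (cK * (6 + -6 * cQ) * z 0) * p1 ∧
    u11 * u22 * u31 = cK * (3 + 3 * cQ) * z 2 * z 0 + (cK * (-6)) * p4 + (cK * (3 + -3 * cQ) * z 0) * r1 ∧
    u11 * u22 * u32 = cK * (-6) * z 4 * z 0 + (cK * (-12)) * r4 + (cK * (-6) * z 0) * p1 ∧
    u11 * u22 * u33 = cK * (-18) * z 7 + (cK * (-3 + -cQ) * z 0) * p2 + (cK * (-3 + cQ) * z 0) * r2 + cK * (6) * z 0 * z 0 * z 0 ∧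
    u11 * u23 * u31 = cK * (-6 + 6 * cQ) * z 4 * z 0 + (cK * (-12)) * r4 + (cK * (-6 + -6 * cQ) * z 0) * p1 ∧
    u11 * u23 * u32 = cK * (18) * z 7 + (cK * (3 + -cQ) * z 0) * p2 + (cK * (3 + cQ) * z 0) * r2 + cK * (6) * z 0 * z 0 * z 0 ∧
    u11 * u23 * u33 = (cK * (12)) * p5 + cK * (12) * z 3 * z 0 + (cK * (12) * z 0) * r3 := by
  have hQ := cQ_sq
  have hK := cK_eq
  simp only [z_0, z_1, z_2, z_3, z_4, z_5, z_6, z_7,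
    u11, u12, u13, u21, u22, u23, u31, u32, u33,
    p1, p2, p3, p4, p5, r1, r2, r3, r4, r5]
  generalize (X 0 : Pol) = a, (X 1 : Pol) = b, (X 2 : Pol) = c, (X 3 : Pol) = d
  generalize cQ = Q at *
  generalize cK = K at *
  refine ⟨?_, ?_, ?_, ?_, ?_, ?_, ?_, ?_, ?_⟩ <;> grind

lemma id_v2 :
    u12 * u21 * u31 = (cK * (12)) * p4 + cK * (12) * z 2 * z 0 + (cK * (12) * z 0) * r1 ∧
    u12 * u21 * u32 = (cK * (24)) * r4 + cK * (-6 + 6 * cQ) * z 4 * z 0 + (cK * (-6 + -6 * cQ) * z 0) * p1 ∧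
    u12 * u21 * u33 = z 7 + (cK * (-4 * cQ) * z 0) * r2 + (cK * (4 * cQ) * z 0) * p2 + cK * (12) * z 0 * z 0 * z 0 ∧
    u12 * u22 * u31 = (cK * (24)) * r4 + cK * (-6 + -6 * cQ) * z 4 * z 0 + (cK * (-6 + 6 * cQ) * z 0) * p1 ∧
    u12 * u22 * u32 = (-1) * z 7 ∧
    u12 * u22 * u33 = (cK * (-24)) * p5 + cK * (-6 + 6 * cQ) * z 3 * z 0 + (cK * (-6 + -6 * cQ) * z 0) * r3 ∧
    u12 * u23 * u31 = (-1) * z 7 + (cK * (-4 * cQ) * z 0) * r2 + (cK * (4 * cQ) * z 0) * p2 + cK * (12) * z 0 * z 0 * z 0 ∧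
    u12 * u23 * u32 = (cK * (24)) * p5 + cK * (6 + 6 * cQ) * z 3 * z 0 + (cK * (6 + -6 * cQ) * z 0) * r3 ∧
    u12 * u23 * u33 = (cK * (12)) * r5 + cK * (12) * z 1 * z 0 + (cK * (12) * z 0) * p3 := by
  have hQ := cQ_sq
  have hK := cK_eq
  simp only [z_0, z_1, z_2, z_3, z_4, z_5, z_6, z_7,
    u11, u12, u13, u21, u22, u23, u31, u32, u33,
    p1, p2, p3, p4, p5, r1, r2, r3, r4, r5]
  generalize (X 0 : Pol) = a, (X 1 : Pol) = b, (X 2 : Pol) = c, (X 3 : Pol) = d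
  generalize cQ = Q at *
  generalize cK = K at *
  refine ⟨?_, ?_, ?_, ?_, ?_, ?_, ?_, ?_, ?_⟩ <;> grind

lemma id_v3 :
    u13 * u21 * u31 = (cK * (12)) * r4 + cK * (-12) * z 4 * z 0 + (cK * (-12) * z 0) * p1 ∧
    u13 * u21 * u32 = (cK * (3 + -cQ) * z 0) * p2 + cK * (-18) * z 7 + (cK * (3 + cQ) * z 0) * r2 + cK * (6) * z 0 * z 0 * z 0 ∧
    u13 * u21 * u33 = cK * (6 + 6 * cQ) * z 3 * z 0 + (cK * (-12)) * p5 + (cK * (6 + -6 * cQ) * z 0) * r3 ∧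
    u13 * u22 * u31 = (cK * (3 + cQ) * z 0) * p2 + cK * (-18) * z 7 + (cK * (3 + -cQ) * z 0) * r2 + cK * (-6) * z 0 * z 0 * z 0 ∧
    u13 * u22 * u32 = cK * (-6) * z 3 * z 0 + (cK * (12)) * p5 + (cK * (-6) * z 0) * r3 ∧
    u13 * u22 * u33 = cK * (-3 + 3 * cQ) * z 1 * z 0 + (cK * (6)) * r5 + (cK * (-3 + -3 * cQ) * z 0) * p3 ∧
    u13 * u23 * u31 = cK * (-6 + 6 * cQ) * z 3 * z 0 + (cK * (12)) * p5 + (cK * (-6 + -6 * cQ) * z 0) * r3 ∧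
    u13 * u23 * u32 = cK * (3 + 3 * cQ) * z 1 * z 0 + (cK * (-6)) * r5 + (cK * (3 + -3 * cQ) * z 0) * p3 ∧
    u13 * u23 * u33 = z 6 := by
  have hQ := cQ_sq
  have hK := cK_eq
  simp only [z_0, z_1, z_2, z_3, z_4, z_5, z_6, z_7,
    u11, u12, u13, u21, u22, u23, u31, u32, u33,
    p1, p2, p3, p4, p5, r1, r2, r3, r4, r5]
  generalize (X 0 : Pol) = a, (X 1 : Pol) = b, (X 2 : Pol) = c, (X 3 : Pol) = d
  generalize cQ = Q at *
  generalize cK = K at *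
  refine ⟨?_, ?_, ?_, ?_, ?_, ?_, ?_, ?_, ?_⟩ <;> grind


/-! ### Action of the generators on the auxiliary polynomials -/

/-- A conjugate of the first generator, acting as a second generator of the quaternion group. -/
def conjSubst : Pol →ₐ[ℂ] Pol :=
  (subst g₂).comp ((subst g₁).comp ((subst g₂).comp (subst g₂)))

lemma neg_X (i : Fin 4) : (subst g₁).comp (subst g₁) (X i) = -X i := by
  have hJ := cJ_sq
  fin_cases i <;>
    simp [a0, a1, a2, a3, subst_cJ] <;> linear_combination X _ * hJ

lemma g₁_u : subst g₁ u11 = u11 ∧ subst g₁ u12 = u12 ∧ subst g₁ u13 = u13 ∧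
    subst g₁ u21 = -u21 ∧ subst g₁ u22 = -u22 ∧ subst g₁ u23 = -u23 ∧
    subst g₁ u31 = -u31 ∧ subst g₁ u32 = -u32 ∧ subst g₁ u33 = -u33 ∧
    subst g₁ (z 0) = z 0 := by
  have hJ := cJ_sq
  simp only [z_0, u11, u12, u13, u21, u22, u23, u31, u32, u33, map_add, map_sub, map_mul,
    map_pow, a0, a1, a2, a3]
  refine ⟨?_, ?_, ?_, ?_, ?_, ?_, ?_, ?_, ?_, ?_⟩ <;> grind

lemma g₂_u :
    subst g₂ u11 = cW ^ 2 * cJ * cH * u21 ∧ subst g₂ u12 = -(cJ * u22) ∧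
    subst g₂ u13 = -(cW * cJ * cH * u23) ∧
    subst g₂ u21 = cW ^ 2 * cJ * u31 ∧ subst g₂ u22 = cJ * u32 ∧
    subst g₂ u23 = -(cW * cJ * u33) ∧
    subst g₂ u31 = -(2 * cW ^ 2 * u11) ∧ subst g₂ u32 = u12 ∧
    subst g₂ u33 = -(2 * cW * u13) ∧
    subst g₂ (z 0) = z 0 := by
  have hJ := cJ_sq
  have hW := cW_sq
  have hH := cH_eq
  simp only [z_0, u11, u12, u13, u21, u22, u23, u31, u32, u33, map_add, map_sub, map_mul,
    map_pow, b0, b1, b2, b3]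
  refine ⟨?_, ?_, ?_, ?_, ?_, ?_, ?_, ?_, ?_, ?_⟩ <;> grind

lemma conj_u : conjSubst u11 = -u11 ∧ conjSubst u12 = -u12 ∧ conjSubst u13 = -u13 ∧
    conjSubst u21 = u21 ∧ conjSubst u22 = u22 ∧ conjSubst u23 = u23 ∧
    conjSubst u31 = -u31 ∧ conjSubst u32 = -u32 ∧ conjSubst u33 = -u33 ∧
    conjSubst (z 0) = z 0 := by
  have hJ := cJ_sq
  have hW := cW_sq
  have hH := cH_eq
  obtain ⟨h1, h2, h3, h4, h5, h6, h7, h8, h9, h0⟩ := g₁_u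
  obtain ⟨k1, k2, k3, k4, k5, k6, k7, k8, k9, k0⟩ := g₂_u
  have two : ∀ M, subst M (2 : Pol) = 2 := fun M => map_ofNat (subst M) 2
  simp only [conjSubst, AlgHom.comp_apply, map_mul, map_neg, map_pow, subst_cJ, subst_cW,
    subst_cH, two, h1, h2, h3, h4, h5, h6, h7, h8, h9, h0, k1, k2, k3, k4, k5, k6, k7, k8, k9, k0]
  refine ⟨?_, ?_, ?_, ?_, ?_, ?_, ?_, ?_, ?_, trivial⟩ <;> grind

lemma g₁_z (i : Fin 8) : subst g₁ (z i) = z i := by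
  have hJ := cJ_sq
  fin_cases i <;>
  simp only [Fin.zero_eta, Fin.mk_one, Fin.reduceFinMk, z_0, z_1, z_2, z_3, z_4, z_5, z_6, z_7,
    map_add, map_sub, map_mul, map_ofNat, subst_cQ, map_pow, a0, a1, a2, a3] <;> grind

/-- Expressions in the quadrics. -/
lemma z_u : z 1 = u23 ^ 2 - (2 * cQ + 2) * u13 ^ 2 ∧ z 2 = u21 ^ 2 + (2 * cQ - 2) * u11 ^ 2 ∧
    z 3 = -(u22 * u23) + (1 - cQ) * (u12 * u13) ∧ z 4 = -(u21 * u22) - (1 + cQ) * (u11 * u12) ∧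
    z 5 = u11 * u21 * u31 ∧ z 6 = u13 * u23 * u33 ∧ z 7 = -(u12 * u22 * u32) := by
  simp only [z_1, z_2, z_3, z_4, z_5, z_6, z_7, u11, u12, u13, u21, u22, u23, u31, u32, u33]
  refine ⟨?_, ?_, ?_, ?_, ?_, ?_, ?_⟩ <;> ring

lemma p_u : p1 = -(u21 * u22) + (cQ - 1) * (u11 * u12) ∧
    p2 = 3 * u22 ^ 2 - cQ * u12 ^ 2 + (6 + 2 * cQ) * (u11 * u13) ∧
    p3 = u23 ^ 2 + (2 * cQ - 2) * u13 ^ 2 ∧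
    p4 = 3 * (u12 * u21 * u31) - z 0 * (2 * u21 ^ 2 - 4 * u11 ^ 2) ∧
    p5 = 3 * (u11 * u23 * u33) - z 0 * (2 * (u12 * u13) - 2 * (u22 * u23)) := by
  simp only [z_0, p1, p2, p3, p4, p5, u11, u12, u13, u21, u22, u23, u31, u33]
  refine ⟨?_, ?_, ?_, ?_, ?_⟩ <;> ring

lemma r_u : r1 = u21 ^ 2 - (2 * cQ + 2) * u11 ^ 2 ∧
    r2 = 3 * u22 ^ 2 + cQ * u12 ^ 2 + (6 - 2 * cQ) * (u11 * u13) ∧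
    r3 = -(u22 * u23) + (1 + cQ) * (u12 * u13) ∧
    r4 = 3 * (u13 * u21 * u31) - z 0 * (2 * (u21 * u22) + 2 * (u11 * u12)) ∧
    r5 = 3 * (u12 * u23 * u33) - z 0 * (2 * u23 ^ 2 - 4 * u13 ^ 2) := by
  simp only [z_0, r1, r2, r3, r4, r5, u11, u12, u13, u21, u22, u23, u31, u33]
  refine ⟨?_, ?_, ?_, ?_, ?_⟩ <;> ring

lemma g₂_z_aux : subst g₂ (z 1) = z 1 ∧ subst g₂ (z 2) = z 2 ∧ subst g₂ (z 3) = z 3 ∧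
    subst g₂ (z 4) = z 4 ∧ subst g₂ (z 5) = z 5 ∧ subst g₂ (z 6) = z 6 ∧ subst g₂ (z 7) = z 7 := by
  have hJ := cJ_sq
  have hW := cW_sq
  have hH := cH_eq
  obtain ⟨e0, e1, e2, e3, e4, e5, e6⟩ := z_u
  obtain ⟨k1, k2, k3, k4, k5, k6, k7, k8, k9, k0⟩ := g₂_u
  simp only [e0, e1, e2, e3, e4, e5, e6, map_add, map_sub, map_mul, map_neg, map_pow, map_ofNat, map_one,
    subst_cQ, k1, k2, k3, k4, k5, k6, k7, k8, k9, k0]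
  simp only [z_0, u11, u12, u13, u21, u22, u23, u31, u32, u33, cQ_eq]
  refine ⟨?_, ?_, ?_, ?_, ?_, ?_, ?_⟩ <;> grind

lemma g₂_z (i : Fin 8) : subst g₂ (z i) = z i := by
  obtain ⟨k1, k2, k3, k4, k5, k6, k7⟩ := g₂_z_aux
  obtain ⟨-, -, -, -, -, -, -, -, -, k0⟩ := g₂_u
  exact match i with
    | 0 => k0
    | 1 => k1
    | 2 => k2
    | 3 => k3
    | 4 => k4
    | 5 => k5
    | 6 => k6
    | 7 => k7

lemma g₂_p : subst g₂ p1 = cW * p1 ∧ subst g₂ p2 = cW * p2 ∧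
    subst g₂ p3 = cW * p3 ∧ subst g₂ p4 = cW * p4 ∧ subst g₂ p5 = cW * p5 := by
  have hJ := cJ_sq
  have hW := cW_sq
  have hH := cH_eq
  obtain ⟨e0, e1, e2, e3, e4⟩ := p_u
  obtain ⟨k1, k2, k3, k4, k5, k6, k7, k8, k9, k0⟩ := g₂_u
  simp only [e0, e1, e2, e3, e4, map_add, map_sub, map_mul, map_neg, map_pow, map_ofNat, map_one,
    subst_cQ, k1, k2, k3, k4, k5, k6, k7, k8, k9, k0]
  simp only [z_0, u11, u12, u13, u21, u22, u23, u31, u32, u33, cQ_eq]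
  refine ⟨?_, ?_, ?_, ?_, ?_⟩ <;> grind

lemma g₂_r : subst g₂ r1 = cW ^ 2 * r1 ∧ subst g₂ r2 = cW ^ 2 * r2 ∧
    subst g₂ r3 = cW ^ 2 * r3 ∧ subst g₂ r4 = cW ^ 2 * r4 ∧ subst g₂ r5 = cW ^ 2 * r5 := by
  have hJ := cJ_sq
  have hW := cW_sq
  have hH := cH_eq
  obtain ⟨e0, e1, e2, e3, e4⟩ := r_u
  obtain ⟨k1, k2, k3, k4, k5, k6, k7, k8, k9, k0⟩ := g₂_u
  simp only [e0, e1, e2, e3, e4, map_add, map_sub, map_mul, map_neg, map_pow, map_ofNat, map_one,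
    subst_cQ, k1, k2, k3, k4, k5, k6, k7, k8, k9, k0]
  simp only [z_0, u11, u12, u13, u21, u22, u23, u31, u32, u33, cQ_eq]
  refine ⟨?_, ?_, ?_, ?_, ?_⟩ <;> grind


/-! ### Membership statements -/

/-- The three families of quadrics. -/
def U1 : Set Pol := {u11, u12, u13}
def U2 : Set Pol := {u21, u22, u23}
def U3 : Set Pol := {u31, u32, u33}
/-- Weight one and weight two elements. -/
def W1 : Set Pol := {p1, p2, p3, p4, p5}
def W2 : Set Pol := {r1, r2, r3, r4, r5}

/-- The algebra generated by the basic invariants. -/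
abbrev B : Subalgebra ℂ Pol := Algebra.adjoin ℂ (Set.range z)

lemma z_mem (i : Fin 8) : z i ∈ B := Algebra.subset_adjoin ⟨i, rfl⟩

lemma cQ_mem (A : Subalgebra ℂ Pol) : cQ ∈ A := A.algebraMap_mem q
lemma cK_mem (A : Subalgebra ℂ Pol) : cK ∈ A := A.algebraMap_mem (1 / 36)
lemma cH_mem (A : Subalgebra ℂ Pol) : cH ∈ A := A.algebraMap_mem (1 / 2)

lemma span_mul_mem (V : Set Pol) {b k : Pol} (hb : b ∈ B) (hk : k ∈ V) :
    b * k ∈ Submodule.span B V :=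
  (Submodule.span B V).smul_mem (⟨b, hb⟩ : B) (Submodule.subset_span hk)

lemma pr_mem : ∀ a ∈ W1, ∀ b ∈ W2, a * b ∈ B := by
  obtain ⟨e11, e12, e13, e14, e15⟩ := id_pr1
  obtain ⟨e21, e22, e23, e24, e25⟩ := id_pr2
  obtain ⟨e31, e32, e33, e34, e35⟩ := id_pr3
  obtain ⟨e41, e42, e43, e44, e45⟩ := id_pr4
  obtain ⟨e51, e52, e53, e54, e55⟩ := id_pr5
  rintro a (rfl | rfl | rfl | rfl | rfl) b (rfl | rfl | rfl | rfl | rfl) <;>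
  simp only [e11, e12, e13, e14, e15, e21, e22, e23, e24, e25, e31, e32, e33, e34, e35,
    e41, e42, e43, e44, e45, e51, e52, e53, e54, e55] <;>
  repeat' with_reducible first
    | exact z_mem _ | exact cQ_mem _ | exact cK_mem _ | exact ofNat_mem _ _
    | exact one_mem _ | apply add_mem | apply neg_mem | apply mul_mem

lemma r1_cube : r1 * r1 * r1 ∈ B := by
  rw [id_cube.1]
  repeat' with_reducible first
    | exact z_mem _ | exact cQ_mem _ | exact cK_mem _ | exact ofNat_mem _ _
    | exact one_mem _ | apply add_mem | apply neg_mem | apply mul_mem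

lemma p3_cube : p3 * p3 * p3 ∈ B := by
  rw [id_cube.2]
  repeat' with_reducible first
    | exact z_mem _ | exact cQ_mem _ | exact cK_mem _ | exact ofNat_mem _ _
    | exact one_mem _ | apply add_mem | apply neg_mem | apply mul_mem

lemma W1_mem : p1 ∈ W1 ∧ p2 ∈ W1 ∧ p3 ∈ W1 ∧ p4 ∈ W1 ∧ p5 ∈ W1 := by simp [W1]
lemma W2_mem : r1 ∈ W2 ∧ r2 ∈ W2 ∧ r3 ∈ W2 ∧ r4 ∈ W2 ∧ r5 ∈ W2 := by simp [W2]

lemma pp_mem : ∀ a ∈ W1, ∀ b ∈ W1,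
    (a = p3 ∧ b = p3) ∨ a * b ∈ Submodule.span B W2 := by
  obtain ⟨h1, h2, h3, h4, h5⟩ := W2_mem
  obtain ⟨e11, e12, e13, e14, e15, -⟩ := id_sq1
  obtain ⟨e22, e23, e24, e25, -⟩ := id_sq2
  obtain ⟨e34, e35, -⟩ := id_sq3
  obtain ⟨e44, e45, -⟩ := id_sq4
  obtain ⟨e55, -⟩ := id_sq5
  rintro a (rfl | rfl | rfl | rfl | rfl) b (rfl | rfl | rfl | rfl | rfl) <;>
  first
  | (refine Or.inr ?_
     first
     | simp only [e11, e12, e13, e14, e15, e22, e23, e24, e25, e34, e35, e44, e45, e55]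
     | (rw [mul_comm]
        simp only [e11, e12, e13, e14, e15, e22, e23, e24, e25, e34, e35, e44, e45, e55])
     repeat' with_reducible first
     | exact z_mem _ | exact cQ_mem _ | exact cK_mem _ | exact ofNat_mem _ _
     | exact one_mem _ | assumption | apply add_mem | apply span_mul_mem
     | apply neg_mem | apply mul_mem)
  | exact Or.inl ⟨rfl, rfl⟩

lemma rr_mem : ∀ a ∈ W2, ∀ b ∈ W2,
    (a = r1 ∧ b = r1) ∨ a * b ∈ Submodule.span B W1 := by
  obtain ⟨h1, h2, h3, h4, h5⟩ := W1_mem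
  obtain ⟨-, -, -, -, -, f12, f13, f14, f15⟩ := id_sq1
  obtain ⟨-, -, -, -, f22, f23, f24, f25⟩ := id_sq2
  obtain ⟨-, -, f33, f34, f35⟩ := id_sq3
  obtain ⟨-, -, f44, f45⟩ := id_sq4
  obtain ⟨-, f55⟩ := id_sq5
  rintro a (rfl | rfl | rfl | rfl | rfl) b (rfl | rfl | rfl | rfl | rfl) <;>
  first
  | (refine Or.inr ?_
     first
     | simp only [f12, f13, f14, f15, f22, f23, f24, f25, f33, f34, f35, f44, f45, f55]
     | (rw [mul_comm]
        simp only [f12, f13, f14, f15, f22, f23, f24, f25, f33, f34, f35, f44, f45, f55])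
     repeat' with_reducible first
     | exact z_mem _ | exact cQ_mem _ | exact cK_mem _ | exact ofNat_mem _ _
     | exact one_mem _ | assumption | apply add_mem | apply span_mul_mem
     | apply neg_mem | apply mul_mem)
  | exact Or.inl ⟨rfl, rfl⟩

lemma span_W1_mul {x b : Pol} (hx : x ∈ Submodule.span B W1) (hb : b ∈ W2) : x * b ∈ B := by
  induction hx using Submodule.span_induction with
  | mem a ha => exact pr_mem a ha b hb
  | zero => rw [zero_mul]; exact zero_mem _
  | add x y _ _ hx hy => rw [add_mul]; exact add_mem hx hy
  | smul c x _ hx => rw [smul_mul_assoc]; exact mul_mem c.2 hx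

lemma span_W2_mul {x b : Pol} (hx : x ∈ Submodule.span B W2) (hb : b ∈ W1) : x * b ∈ B := by
  induction hx using Submodule.span_induction with
  | mem a ha => rw [mul_comm]; exact pr_mem b hb a ha
  | zero => rw [zero_mul]; exact zero_mem _
  | add x y _ _ hx hy => rw [add_mul]; exact add_mem hx hy
  | smul c x _ hx => rw [smul_mul_assoc]; exact mul_mem c.2 hx

/-- The last reduction step. -/
lemma reduce_four (f : Pol) (hf : f ∈ Algebra.adjoin ℂ (Set.range z ∪ (W1 ∪ W2)))
    (hσ : subst g₂ f = f) : f ∈ B := by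
  have hr1 : r1 ∈ W2 := W2_mem.1
  have hp3 : p3 ∈ W1 := W1_mem.2.2.1
  have hW3 : cW ^ 3 = 1 := by
    have := cW_sq
    grind
  obtain ⟨s1, s2, s3, s4, s5⟩ := g₂_p
  obtain ⟨t1, t2, t3, t4, t5⟩ := g₂_r
  refine step_three (Set.range z) (W1 ∪ {r1 * r1}) (W2 ∪ {p3 * p3}) _ (subst g₂)
    ?_ ?_ ?_ ?_ ?_ ?_ ?_ f hf hσ
  · rintro _ ⟨i, rfl⟩
    exact g₂_z i
  · rintro k ((rfl | rfl | rfl | rfl | rfl) | hk)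
    · exact s1
    · exact s2
    · exact s3
    · exact s4
    · exact s5
    · rw [Set.mem_singleton_iff] at hk
      rw [hk, map_mul, t1]
      linear_combination (cW * r1 * r1) * hW3
  · rintro k ((rfl | rfl | rfl | rfl | rfl) | hk)
    · exact t1
    · exact t2
    · exact t3
    · exact t4
    · exact t5
    · rw [Set.mem_singleton_iff] at hk
      rw [hk, map_mul, s3]
      ring
  · rintro a (ha | ha) b (hb | hb)
    · rcases pp_mem a ha b hb with ⟨h1, h2⟩ | h
      · rw [h1, h2]
        exact Submodule.subset_span (Or.inr rfl)
      · exact Submodule.span_mono Set.subset_union_left h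
    · rw [Set.mem_singleton_iff] at hb
      rw [hb, ← mul_assoc]
      exact span_mul_mem _ (pr_mem a ha _ hr1) (Or.inl hr1)
    · rw [Set.mem_singleton_iff] at ha
      rw [ha, mul_comm (r1 * r1) b, ← mul_assoc]
      exact span_mul_mem _ (pr_mem b hb _ hr1) (Or.inl hr1)
    · rw [Set.mem_singleton_iff] at ha hb
      rw [ha, hb, ← mul_assoc]
      exact span_mul_mem _ r1_cube (Or.inl hr1)
  · rintro a (ha | ha) b (hb | hb)
    · exact pr_mem a ha b hb
    · rw [Set.mem_singleton_iff] at hb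
      rw [hb, ← mul_assoc]
      rcases pp_mem a ha p3 hp3 with ⟨h1, -⟩ | h
      · rw [h1]
        exact p3_cube
      · exact span_W2_mul h hp3
    · rw [Set.mem_singleton_iff] at ha
      rw [ha, mul_comm (r1 * r1) b, ← mul_assoc]
      rcases rr_mem b hb r1 hr1 with ⟨h1, -⟩ | h
      · rw [h1]
        exact r1_cube
      · exact span_W1_mul h hr1
    · rw [Set.mem_singleton_iff] at ha hb
      have e : a * b = (p3 * r1) * (p3 * r1) := by
        rw [ha, hb]
        ring
      rw [e]
      exact mul_mem (pr_mem _ hp3 _ hr1) (pr_mem _ hp3 _ hr1)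
  · rintro a (ha | ha) b (hb | hb)
    · rcases rr_mem a ha b hb with ⟨h1, h2⟩ | h
      · rw [h1, h2]
        exact Submodule.subset_span (Or.inr rfl)
      · exact Submodule.span_mono Set.subset_union_left h
    · rw [Set.mem_singleton_iff] at hb
      rw [hb, ← mul_assoc, mul_comm a p3]
      exact span_mul_mem _ (pr_mem _ hp3 a ha) (Or.inl hp3)
    · rw [Set.mem_singleton_iff] at ha
      rw [ha, mul_comm (p3 * p3) b, ← mul_assoc, mul_comm b p3]
      exact span_mul_mem _ (pr_mem _ hp3 b hb) (Or.inl hp3)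
    · rw [Set.mem_singleton_iff] at ha hb
      rw [ha, hb, ← mul_assoc]
      exact span_mul_mem _ p3_cube (Or.inl hp3)
  · rintro a (ha | ha | ha)
    · exact Or.inl (Algebra.subset_adjoin ha)
    · exact Or.inr (Or.inl (Or.inl ha))
    · exact Or.inr (Or.inr (Or.inl ha))

/-- Pairwise products. -/
def prodSet (U V : Set Pol) : Set Pol := {x | ∃ a ∈ U, ∃ b ∈ V, a * b = x}

/-- The algebra generated by the semi-invariants. -/
abbrev A4 : Subalgebra ℂ Pol := Algebra.adjoin ℂ (Set.range z ∪ (W1 ∪ W2))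

lemma z_mem4 (i : Fin 8) : z i ∈ A4 := Algebra.subset_adjoin (Or.inl ⟨i, rfl⟩)

lemma W1_mem4 : p1 ∈ A4 ∧ p2 ∈ A4 ∧ p3 ∈ A4 ∧ p4 ∈ A4 ∧ p5 ∈ A4 := by
  obtain ⟨h1, h2, h3, h4, h5⟩ := W1_mem
  exact ⟨Algebra.subset_adjoin (Or.inr (Or.inl h1)), Algebra.subset_adjoin (Or.inr (Or.inl h2)),
    Algebra.subset_adjoin (Or.inr (Or.inl h3)), Algebra.subset_adjoin (Or.inr (Or.inl h4)),
    Algebra.subset_adjoin (Or.inr (Or.inl h5))⟩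

lemma W2_mem4 : r1 ∈ A4 ∧ r2 ∈ A4 ∧ r3 ∈ A4 ∧ r4 ∈ A4 ∧ r5 ∈ A4 := by
  obtain ⟨h1, h2, h3, h4, h5⟩ := W2_mem
  exact ⟨Algebra.subset_adjoin (Or.inr (Or.inr h1)), Algebra.subset_adjoin (Or.inr (Or.inr h2)),
    Algebra.subset_adjoin (Or.inr (Or.inr h3)), Algebra.subset_adjoin (Or.inr (Or.inr h4)),
    Algebra.subset_adjoin (Or.inr (Or.inr h5))⟩

lemma uu_mem1 : ∀ a ∈ U1, ∀ b ∈ U1, a * b ∈ A4 := by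
  obtain ⟨h1, h2, h3, h4, h5⟩ := W1_mem4
  obtain ⟨k1, k2, k3, k4, k5⟩ := W2_mem4
  obtain ⟨e11, e12, e13, e22, e23, e33⟩ := id_u1
  rintro a (rfl | rfl | rfl) b (rfl | rfl | rfl) <;>
  (first
   | simp only [e11, e12, e13, e22, e23, e33]
   | (rw [mul_comm]
      simp only [e11, e12, e13, e22, e23, e33])
   repeat' with_reducible first
   | exact z_mem4 _ | exact cQ_mem _ | exact cK_mem _ | exact ofNat_mem _ _
   | exact one_mem _ | assumption | apply add_mem | apply neg_mem | apply mul_mem)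

lemma uu_mem2 : ∀ a ∈ U2, ∀ b ∈ U2, a * b ∈ A4 := by
  obtain ⟨h1, h2, h3, h4, h5⟩ := W1_mem4
  obtain ⟨k1, k2, k3, k4, k5⟩ := W2_mem4
  obtain ⟨e11, e12, e13, e22, e23, e33⟩ := id_u2
  rintro a (rfl | rfl | rfl) b (rfl | rfl | rfl) <;>
  (first
   | simp only [e11, e12, e13, e22, e23, e33]
   | (rw [mul_comm]
      simp only [e11, e12, e13, e22, e23, e33])
   repeat' with_reducible first
   | exact z_mem4 _ | exact cQ_mem _ | exact cK_mem _ | exact ofNat_mem _ _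
   | exact one_mem _ | assumption | apply add_mem | apply neg_mem | apply mul_mem)

lemma uu_mem3 : ∀ a ∈ U3, ∀ b ∈ U3, a * b ∈ A4 := by
  obtain ⟨h1, h2, h3, h4, h5⟩ := W1_mem4
  obtain ⟨k1, k2, k3, k4, k5⟩ := W2_mem4
  obtain ⟨e11, e12, e13, e22, e23, e33⟩ := id_u3
  rintro a (rfl | rfl | rfl) b (rfl | rfl | rfl) <;>
  (first
   | simp only [e11, e12, e13, e22, e23, e33]
   | (rw [mul_comm]
      simp only [e11, e12, e13, e22, e23, e33])
   repeat' with_reducible first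
   | exact z_mem4 _ | exact cQ_mem _ | exact cK_mem _ | exact ofNat_mem _ _
   | exact one_mem _ | assumption | apply add_mem | apply neg_mem | apply mul_mem)

lemma uuu_mem1 : ∀ b ∈ U2, ∀ c ∈ U3, u11 * b * c ∈ A4 := by
  obtain ⟨h1, h2, h3, h4, h5⟩ := W1_mem4
  obtain ⟨k1, k2, k3, k4, k5⟩ := W2_mem4
  obtain ⟨e11, e12, e13, e21, e22, e23, e31, e32, e33⟩ := id_v1
  rintro b (rfl | rfl | rfl) c (rfl | rfl | rfl) <;>
  (simp only [e11, e12, e13, e21, e22, e23, e31, e32, e33]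
   repeat' with_reducible first
   | exact z_mem4 _ | exact cQ_mem _ | exact cK_mem _ | exact ofNat_mem _ _
   | exact one_mem _ | assumption | apply add_mem | apply neg_mem | apply mul_mem)

lemma uuu_mem2 : ∀ b ∈ U2, ∀ c ∈ U3, u12 * b * c ∈ A4 := by
  obtain ⟨h1, h2, h3, h4, h5⟩ := W1_mem4
  obtain ⟨k1, k2, k3, k4, k5⟩ := W2_mem4
  obtain ⟨e11, e12, e13, e21, e22, e23, e31, e32, e33⟩ := id_v2
  rintro b (rfl | rfl | rfl) c (rfl | rfl | rfl) <;>
  (simp only [e11, e12, e13, e21, e22, e23, e31, e32, e33]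
   repeat' with_reducible first
   | exact z_mem4 _ | exact cQ_mem _ | exact cK_mem _ | exact ofNat_mem _ _
   | exact one_mem _ | assumption | apply add_mem | apply neg_mem | apply mul_mem)

lemma uuu_mem3 : ∀ b ∈ U2, ∀ c ∈ U3, u13 * b * c ∈ A4 := by
  obtain ⟨h1, h2, h3, h4, h5⟩ := W1_mem4
  obtain ⟨k1, k2, k3, k4, k5⟩ := W2_mem4
  obtain ⟨e11, e12, e13, e21, e22, e23, e31, e32, e33⟩ := id_v3
  rintro b (rfl | rfl | rfl) c (rfl | rfl | rfl) <;>
  (simp only [e11, e12, e13, e21, e22, e23, e31, e32, e33]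
   repeat' with_reducible first
   | exact z_mem4 _ | exact cQ_mem _ | exact cK_mem _ | exact ofNat_mem _ _
   | exact one_mem _ | assumption | apply add_mem | apply neg_mem | apply mul_mem)

lemma uuu_mem : ∀ a ∈ U1, ∀ b ∈ U2, ∀ c ∈ U3, a * b * c ∈ A4 := by
  rintro a (rfl | rfl | rfl)
  · exact uuu_mem1
  · exact uuu_mem2
  · exact uuu_mem3

/-- Generators after the second step. -/
def S2 : Set Pol := {z 0} ∪ (U1 ∪ (U2 ∪ U3))
/-- Generators after the third step. -/
def S3 : Set Pol := {z 0} ∪ (U1 ∪ (prodSet U2 U2 ∪ (prodSet U3 U3 ∪ prodSet U2 U3)))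
/-- Generators after the fourth step. -/
def S4 : Set Pol :=
  {z 0} ∪ (prodSet U1 U1 ∪ (prodSet U2 U2 ∪ (prodSet U3 U3 ∪ prodSet U1 (prodSet U2 U3))))

lemma S4_le : Algebra.adjoin ℂ S4 ≤ A4 := by
  refine Algebra.adjoin_le ?_
  rintro x (hx | ⟨a, ha, b, hb, rfl⟩ | ⟨a, ha, b, hb, rfl⟩ | ⟨a, ha, b, hb, rfl⟩ |
    ⟨a, ha, _, ⟨b, hb, c, hc, rfl⟩, rfl⟩)
  · rw [Set.mem_singleton_iff] at hx
    rw [hx]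
    exact z_mem4 0
  · exact uu_mem1 a ha b hb
  · exact uu_mem2 a ha b hb
  · exact uu_mem3 a ha b hb
  · rw [← mul_assoc]
    exact uuu_mem a ha b hb c hc

lemma conj_U1 : ∀ a ∈ U1, conjSubst a = -a := by
  obtain ⟨h1, h2, h3, h4, h5, h6, h7, h8, h9, h0⟩ := conj_u
  rintro a (rfl | rfl | rfl)
  · exact h1
  · exact h2
  · exact h3
lemma conj_U2 : ∀ a ∈ U2, conjSubst a = a := by
  obtain ⟨h1, h2, h3, h4, h5, h6, h7, h8, h9, h0⟩ := conj_u
  rintro a (rfl | rfl | rfl)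
  · exact h4
  · exact h5
  · exact h6
lemma conj_U3 : ∀ a ∈ U3, conjSubst a = -a := by
  obtain ⟨h1, h2, h3, h4, h5, h6, h7, h8, h9, h0⟩ := conj_u
  rintro a (rfl | rfl | rfl)
  · exact h7
  · exact h8
  · exact h9
lemma conj_z0 : ∀ a ∈ ({z 0} : Set Pol), conjSubst a = a := by
  obtain ⟨h1, h2, h3, h4, h5, h6, h7, h8, h9, h0⟩ := conj_u
  intro a ha
  rw [Set.mem_singleton_iff] at ha
  rw [ha, h0]
lemma g₁_U1 : ∀ a ∈ U1, subst g₁ a = a := by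
  obtain ⟨h1, h2, h3, h4, h5, h6, h7, h8, h9, h0⟩ := g₁_u
  rintro a (rfl | rfl | rfl)
  · exact h1
  · exact h2
  · exact h3
lemma g₁_U2 : ∀ a ∈ U2, subst g₁ a = -a := by
  obtain ⟨h1, h2, h3, h4, h5, h6, h7, h8, h9, h0⟩ := g₁_u
  rintro a (rfl | rfl | rfl)
  · exact h4
  · exact h5
  · exact h6
lemma g₁_U3 : ∀ a ∈ U3, subst g₁ a = -a := by
  obtain ⟨h1, h2, h3, h4, h5, h6, h7, h8, h9, h0⟩ := g₁_u
  rintro a (rfl | rfl | rfl)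
  · exact h7
  · exact h8
  · exact h9
lemma g₁_z0 : ∀ a ∈ ({z 0} : Set Pol), subst g₁ a = a := by
  intro a ha
  rw [Set.mem_singleton_iff] at ha
  rw [ha, g₁_z]

lemma reduce_three (f : Pol) (hf : f ∈ Algebra.adjoin ℂ S3) (hσ : conjSubst f = f) :
    f ∈ Algebra.adjoin ℂ S4 := by
  have m22 : ∀ a ∈ U2, ∀ b ∈ U2, a * b ∈ Algebra.adjoin ℂ S4 := fun a ha b hb =>
    Algebra.subset_adjoin (Or.inr (Or.inr (Or.inl ⟨a, ha, b, hb, rfl⟩)))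
  have m33 : ∀ a ∈ U3, ∀ b ∈ U3, a * b ∈ Algebra.adjoin ℂ S4 := fun a ha b hb =>
    Algebra.subset_adjoin (Or.inr (Or.inr (Or.inr (Or.inl ⟨a, ha, b, hb, rfl⟩))))
  have m123 : ∀ a ∈ U1, ∀ b ∈ prodSet U2 U3, a * b ∈ Algebra.adjoin ℂ S4 := fun a ha b hb =>
    Algebra.subset_adjoin (Or.inr (Or.inr (Or.inr (Or.inr ⟨a, ha, b, hb, rfl⟩))))
  refine step_two S4 (U1 ∪ prodSet U2 U3) S3 conjSubst ?_ ?_ ?_ ?_ f hf hσ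
  · rintro x (hx | ⟨a, ha, b, hb, rfl⟩ | ⟨a, ha, b, hb, rfl⟩ | ⟨a, ha, b, hb, rfl⟩ |
      ⟨a, ha, _, ⟨b, hb, c, hc, rfl⟩, rfl⟩)
    · exact conj_z0 x hx
    · rw [map_mul, conj_U1 a ha, conj_U1 b hb, neg_mul_neg]
    · rw [map_mul, conj_U2 a ha, conj_U2 b hb]
    · rw [map_mul, conj_U3 a ha, conj_U3 b hb, neg_mul_neg]
    · rw [map_mul, map_mul, conj_U1 a ha, conj_U2 b hb, conj_U3 c hc]
      ring
  · rintro x (hx | ⟨a, ha, b, hb, rfl⟩)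
    · exact conj_U1 x hx
    · rw [map_mul, conj_U2 a ha, conj_U3 b hb]
      ring
  · rintro x (hx | hx) y (hy | hy)
    · exact Algebra.subset_adjoin (Or.inr (Or.inl ⟨x, hx, y, hy, rfl⟩))
    · exact m123 x hx y hy
    · rw [mul_comm x y]
      exact m123 y hy x hx
    · obtain ⟨a, ha, b, hb, rfl⟩ := hx
      obtain ⟨c, hc, d, hd, rfl⟩ := hy
      rw [mul_mul_mul_comm]
      exact mul_mem (m22 a ha c hc) (m33 b hb d hd)
  · rintro x (hx | hx | ⟨a, ha, b, hb, rfl⟩ | ⟨a, ha, b, hb, rfl⟩ | hx)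
    · exact Or.inl (Algebra.subset_adjoin (Or.inl hx))
    · exact Or.inr (Or.inl hx)
    · exact Or.inl (m22 a ha b hb)
    · exact Or.inl (m33 a ha b hb)
    · exact Or.inr (Or.inr hx)

lemma reduce_two (f : Pol) (hf : f ∈ Algebra.adjoin ℂ S2) (hσ : subst g₁ f = f) :
    f ∈ Algebra.adjoin ℂ S3 := by
  refine step_two S3 (U2 ∪ U3) S2 (subst g₁) ?_ ?_ ?_ ?_ f hf hσ
  · rintro x (hx | hx | ⟨a, ha, b, hb, rfl⟩ | ⟨a, ha, b, hb, rfl⟩ | ⟨a, ha, b, hb, rfl⟩)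
    · exact g₁_z0 x hx
    · exact g₁_U1 x hx
    · rw [map_mul, g₁_U2 a ha, g₁_U2 b hb, neg_mul_neg]
    · rw [map_mul, g₁_U3 a ha, g₁_U3 b hb, neg_mul_neg]
    · rw [map_mul, g₁_U2 a ha, g₁_U3 b hb, neg_mul_neg]
  · rintro x (hx | hx)
    · exact g₁_U2 x hx
    · exact g₁_U3 x hx
  · rintro x (hx | hx) y (hy | hy)
    · exact Algebra.subset_adjoin (Or.inr (Or.inr (Or.inl ⟨x, hx, y, hy, rfl⟩)))
    · exact Algebra.subset_adjoin (Or.inr (Or.inr (Or.inr (Or.inr ⟨x, hx, y, hy, rfl⟩))))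
    · rw [mul_comm x y]
      exact Algebra.subset_adjoin (Or.inr (Or.inr (Or.inr (Or.inr ⟨y, hy, x, hx, rfl⟩))))
    · exact Algebra.subset_adjoin (Or.inr (Or.inr (Or.inr (Or.inl ⟨x, hx, y, hy, rfl⟩))))
  · rintro x (hx | hx | hx)
    · exact Or.inl (Algebra.subset_adjoin (Or.inl hx))
    · exact Or.inl (Algebra.subset_adjoin (Or.inr (Or.inl hx)))
    · exact Or.inr hx

/-- The quadratic monomials. -/
def S1 : Set Pol := prodSet (Set.range X) (Set.range X)

lemma u_mem2 : (u11 ∈ Algebra.adjoin ℂ S2 ∧ u12 ∈ Algebra.adjoin ℂ S2 ∧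
    u13 ∈ Algebra.adjoin ℂ S2) ∧ (u21 ∈ Algebra.adjoin ℂ S2 ∧ u22 ∈ Algebra.adjoin ℂ S2 ∧
    u23 ∈ Algebra.adjoin ℂ S2) ∧ u31 ∈ Algebra.adjoin ℂ S2 ∧ u32 ∈ Algebra.adjoin ℂ S2 ∧
    u33 ∈ Algebra.adjoin ℂ S2 := by
  have m1 : ∀ a ∈ U1, a ∈ Algebra.adjoin ℂ S2 := fun a ha =>
    Algebra.subset_adjoin (Or.inr (Or.inl ha))
  have m2 : ∀ a ∈ U2, a ∈ Algebra.adjoin ℂ S2 := fun a ha =>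
    Algebra.subset_adjoin (Or.inr (Or.inr (Or.inl ha)))
  have m3 : ∀ a ∈ U3, a ∈ Algebra.adjoin ℂ S2 := fun a ha =>
    Algebra.subset_adjoin (Or.inr (Or.inr (Or.inr ha)))
  refine ⟨⟨m1 _ ?_, m1 _ ?_, m1 _ ?_⟩, ⟨m2 _ ?_, m2 _ ?_, m2 _ ?_⟩, m3 _ ?_, m3 _ ?_, m3 _ ?_⟩ <;>
  simp [U1, U2, U3]

lemma XX_eq : X 0 * X 0 = cH * (u21 + u31) ∧ X 0 * X 1 = u11 ∧
    X 0 * X 2 = cH * (z 0 + u12) ∧ X 0 * X 3 = cH * (u22 + u32) ∧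
    X 1 * X 1 = cH * (u21 - u31) ∧ X 1 * X 2 = cH * (u32 - u22) ∧
    X 1 * X 3 = cH * (z 0 - u12) ∧ X 2 * X 2 = cH * (u23 + u33) ∧
    X 2 * X 3 = u13 ∧ X 3 * X 3 = cH * (u23 - u33) := by
  have hH := cH_eq
  simp only [z_0, u11, u12, u13, u21, u22, u23, u31, u32, u33]
  generalize (X 0 : Pol) = a, (X 1 : Pol) = b, (X 2 : Pol) = c, (X 3 : Pol) = d
  generalize cH = H at *
  refine ⟨?_, ?_, ?_, ?_, ?_, ?_, ?_, ?_, ?_, ?_⟩ <;> grind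

lemma S1_le : Algebra.adjoin ℂ S1 ≤ Algebra.adjoin ℂ S2 := by
  obtain ⟨⟨h1, h2, h3⟩, ⟨h4, h5, h6⟩, h7, h8, h9⟩ := u_mem2
  have h0 : z 0 ∈ Algebra.adjoin ℂ S2 := Algebra.subset_adjoin (Or.inl rfl)
  have hH := cH_mem (Algebra.adjoin ℂ S2)
  obtain ⟨e00, e01, e02, e03, e11, e12, e13, e22, e23, e33⟩ := XX_eq
  have key : ∀ i j : Fin 4, i ≤ j → (X i * X j : Pol) ∈ Algebra.adjoin ℂ S2 := by
    intro i j hij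
    fin_cases i <;> fin_cases j <;>
    first
    | exact absurd hij (by decide)
    | (simp only [Fin.zero_eta, Fin.mk_one, Fin.reduceFinMk, e00, e01, e02, e03, e11, e12, e13,
        e22, e23, e33]
       repeat' with_reducible first
       | assumption | apply add_mem | apply sub_mem | apply mul_mem)
  refine Algebra.adjoin_le ?_
  rintro _ ⟨_, ⟨i, rfl⟩, _, ⟨j, rfl⟩, rfl⟩
  rcases le_total i j with h | h
  · exact key i j h
  · rw [mul_comm]
    exact key j i h

lemma reduce_one (f : Pol) (hσ : subst g₁ (subst g₁ f) = f) : f ∈ Algebra.adjoin ℂ S1 := by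
  refine step_two S1 (Set.range X) (Set.range X) ((subst g₁).comp (subst g₁)) ?_ ?_ ?_ ?_ f ?_ hσ
  · rintro _ ⟨_, ⟨i, rfl⟩, _, ⟨j, rfl⟩, rfl⟩
    rw [map_mul, neg_X, neg_X, neg_mul_neg]
  · rintro _ ⟨i, rfl⟩
    exact neg_X i
  · exact fun a ha b hb => Algebra.subset_adjoin ⟨a, ha, b, hb, rfl⟩
  · exact fun a ha => Or.inr ha
  · rw [MvPolynomial.adjoin_range_X]
    exact Algebra.mem_top

/-- Invariance under both generators suffices for membership. -/
lemma mem_of_invariant (f : Pol) (h1 : subst g₁ f = f) (h2 : subst g₂ f = f) : f ∈ B := by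
  refine reduce_four f (S4_le (reduce_three f (reduce_two f (S1_le (reduce_one f ?_)) h1) ?_)) h2
  · rw [h1, h1]
  · simp only [conjSubst, AlgHom.comp_apply, h1, h2]

lemma invariant_of_mem (M : Matrix (Fin 4) (Fin 4) ℂ) (hM : ∀ i, subst M (z i) = z i)
    (f : Pol) (hf : f ∈ B) : subst M f = f := by
  have h : B ≤ AlgHom.equalizer (subst M) (AlgHom.id ℂ Pol) := by
    refine Algebra.adjoin_le ?_
    rintro _ ⟨i, rfl⟩
    exact hM i
  exact h hf

theorem invariant_ring_generated_by_basic_invariants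
    (G₁ G₂ : GL (Fin 4) ℂ)
    (hG₁ : (G₁ : Matrix (Fin 4) (Fin 4) ℂ) = g₁)
    (hG₂ : (G₂ : Matrix (Fin 4) (Fin 4) ℂ) = g₂) :
    ∀ f : MvPolynomial (Fin 4) ℂ,
      (∀ g ∈ Subgroup.closure {G₁, G₂},
        subst (g : Matrix (Fin 4) (Fin 4) ℂ) f = f)
      ↔ f ∈ Algebra.adjoin ℂ (Set.range z) := by
  intro f
  constructor
  · intro h
    refine mem_of_invariant f ?_ ?_
    · rw [← hG₁]
      exact h G₁ (Subgroup.subset_closure (Or.inl rfl))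
    · rw [← hG₂]
      exact h G₂ (Subgroup.subset_closure (Or.inr rfl))
  · intro hf g hg
    induction hg using Subgroup.closure_induction with
    | mem x hx =>
      rcases hx with rfl | hx
      · rw [hG₁]
        exact invariant_of_mem _ g₁_z f hf
      · rw [Set.mem_singleton_iff] at hx
        rw [hx, hG₂]
        exact invariant_of_mem _ g₂_z f hf
    | one => exact subst_one f
    | mul x y _ _ hx hy => rw [Units.val_mul, subst_mul, hx, hy]
    | inv x _ hx =>
      have h : subst ((x * x⁻¹ : GL (Fin 4) ℂ) : Matrix (Fin 4) (Fin 4) ℂ) f = f := by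
        rw [mul_inv_cancel]
        exact subst_one f
      rw [Units.val_mul, subst_mul, hx] at h
      exact h

end
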